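/- The limit of the CACTO value sequence satisfies Bellman's optimality equation: in the CACTO iteration, the pointwise limit V^∞_t(x) = lim_{k→∞} V^{TO(π^k)}_t(x) (which exists by monotonicity and boundedness) satisfies V^∞_T(x) = lT(x) and, for all t < T and all x, V^∞_t(x) = min over u ∈ U of [l_t(x, u) + V^∞_{t+1}(f_t(x, u))]; consequently V^∞ = V*. -/

import Mathlib

/-- Value function of a policy `π`, defined by backward recursion:
`V^π_T(x) = lT x` and for `t < T`,
`V^π_t(x) = l t x (π t x) + V^π_{t+1}(f t x (π t x))`. -/
def val {S U : Type*} (T : ℕ) (f : Fin T → S → U → S) (l : Fin T → S → U → ℝ)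
    (lT : S → ℝ) (π : Fin T → S → U) : Fin (T + 1) → S → ℝ
  | t, x =>
    if h : (t : ℕ) < T then
      l ⟨t, h⟩ x (π ⟨t, h⟩ x) +
        val T f l lT π ⟨(t : ℕ) + 1, by omega⟩ (f ⟨t, h⟩ x (π ⟨t, h⟩ x))
    else lT x
  termination_by t _ => T - (t : ℕ)
  decreasing_by omega

/-- `π'` is greedy with respect to `W`. -/
def IsGreedy {S U : Type*} (T : ℕ) (f : Fin T → S → U → S) (l : Fin T → S → U → ℝ)
    (π' : Fin T → S → U) (W : Fin (T + 1) → S → ℝ) : Prop :=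
  ∀ (t : Fin T) (x : S) (u : U),
    l t x (π' t x) + W t.succ (f t x (π' t x)) ≤ l t x u + W t.succ (f t x u)

/-- The optimal value function: pointwise minimum of `val` over all (finitely many) policies. -/
noncomputable def optVal {S U : Type*} [Fintype S] [DecidableEq S] [Fintype U] [Nonempty U]
    (T : ℕ) (f : Fin T → S → U → S) (l : Fin T → S → U → ℝ) (lT : S → ℝ) :
    Fin (T + 1) → S → ℝ :=
  fun t x =>
    Finset.univ.inf' Finset.univ_nonempty (fun π : Fin T → S → U => val T f l lT π t x)

theorem val_last {S U : Type*} (T : ℕ) (f : Fin T → S → U → S) (l : Fin T → S → U → ℝ)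
    (lT : S → ℝ) (p : Fin T → S → U) (x : S) :
    val T f l lT p (Fin.last T) x = lT x := by
  rw [val]
  simp

theorem val_castSucc {S U : Type*} (T : ℕ) (f : Fin T → S → U → S) (l : Fin T → S → U → ℝ)
    (lT : S → ℝ) (p : Fin T → S → U) (t : Fin T) (x : S) :
    val T f l lT p t.castSucc x =
      l t x (p t x) + val T f l lT p t.succ (f t x (p t x)) := by
  rw [val, dif_pos (show (t.castSucc : ℕ) < T from t.isLt)]
  rfl

/-- A subsolution of the Bellman recursion along `p` is dominated by the value of `p`. -/
theorem le_val_of_subsolution {S U : Type*} (T : ℕ) (f : Fin T → S → U → S)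
    (l : Fin T → S → U → ℝ) (lT : S → ℝ) (p : Fin T → S → U) (W : Fin (T + 1) → S → ℝ)
    (hlast : ∀ x, W (Fin.last T) x ≤ lT x)
    (hstep : ∀ t x, W t.castSucc x ≤ l t x (p t x) + W t.succ (f t x (p t x)))
    (t : Fin (T + 1)) (x : S) : W t x ≤ val T f l lT p t x := by
  induction t using Fin.reverseInduction generalizing x with
  | last => exact (hlast x).trans_eq (val_last T f l lT p x).symm
  | cast t ih =>
    rw [val_castSucc]
    exact (hstep t x).trans (add_le_add_right (ih _) _)

/-- Policy improvement: a policy greedy for the value of `p` is at least as good as `p`. -/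
theorem val_le_of_isGreedy {S U : Type*} (T : ℕ) (f : Fin T → S → U → S)
    (l : Fin T → S → U → ℝ) (lT : S → ℝ) (p q : Fin T → S → U)
    (hq : IsGreedy T f l q (val T f l lT p)) (t : Fin (T + 1)) (x : S) :
    val T f l lT q t x ≤ val T f l lT p t x := by
  induction t using Fin.reverseInduction generalizing x with
  | last => rw [val_last, val_last]
  | cast t ih =>
    rw [val_castSucc, val_castSucc]
    exact (add_le_add_right (ih _) _).trans (hq t x (p t x))

variable {S U : Type*} [Fintype S] [DecidableEq S] [Nonempty S] [Fintype U] [Nonempty U]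
  (T : ℕ) (f : Fin T → S → U → S) (l : Fin T → S → U → ℝ) (lT : S → ℝ)

theorem cacto_limit_bellman
    (TO : (Fin T → S → U) → (Fin T → S → U))
    (hTO : ∀ (p : Fin T → S → U) (t : Fin (T + 1)) (x : S),
      val T f l lT (TO p) t x ≤ val T f l lT p t x)
    (π : ℕ → Fin T → S → U)
    (hgreedy : ∀ k : ℕ, IsGreedy T f l (π (k + 1)) (val T f l lT (TO (π k))))
    (Vinf : Fin (T + 1) → S → ℝ)
    (hlim : ∀ (t : Fin (T + 1)) (x : S),
      Filter.Tendsto (fun k : ℕ => val T f l lT (TO (π k)) t x)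
        Filter.atTop (nhds (Vinf t x))) :
    (∀ x : S, Vinf (Fin.last T) x = lT x) ∧
    (∀ (t : Fin T) (x : S),
      Vinf t.castSucc x =
        Finset.univ.inf' Finset.univ_nonempty
          (fun u : U => l t x u + Vinf t.succ (f t x u))) ∧
    Vinf = optVal T f l lT := by
  have hlast (x : S) : Vinf (Fin.last T) x = lT x := by
    have h := hlim (Fin.last T) x
    simp only [val_last] at h
    exact tendsto_nhds_unique h tendsto_const_nhds
  have hcand (t : Fin T) (x : S) (u : U) :
      Filter.Tendsto (fun k => l t x u + val T f l lT (TO (π k)) t.succ (f t x u))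
        Filter.atTop (nhds (l t x u + Vinf t.succ (f t x u))) :=
    (hlim t.succ (f t x u)).const_add _
  have hle (t : Fin T) (x : S) (u : U) :
      Vinf t.castSucc x ≤ l t x u + Vinf t.succ (f t x u) := by
    refine le_of_tendsto_of_tendsto' ((hlim t.castSucc x).comp (Filter.tendsto_add_atTop_nat 1))
      (hcand t x u) fun k => ?_
    refine (hTO (π (k + 1)) t.castSucc x).trans ?_
    rw [val_castSucc]
    exact (add_le_add_right (val_le_of_isGreedy T f l lT _ _ (hgreedy k) _ _) _).trans
      (hgreedy k t x u)
  refine ⟨hlast, fun t x => le_antisymm ?_ ?_, ?_⟩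
  · exact Finset.le_inf' _ _ fun u _ => hle t x u
  · refine le_of_tendsto_of_tendsto'
      (Filter.Tendsto.finset_inf'_nhds_apply Finset.univ_nonempty fun u _ => hcand t x u)
      (hlim t.castSucc x) fun k => ?_
    rw [val_castSucc]
    exact Finset.inf'_le _ (Finset.mem_univ _)
  · funext t x
    refine le_antisymm ?_ ?_
    · exact Finset.le_inf' _ _ fun p _ =>
        le_val_of_subsolution T f l lT p Vinf (fun y => (hlast y).le)
          (fun t y => hle t y (p t y)) t x
    · exact ge_of_tendsto' (hlim t x) fun k => Finset.inf'_le _ (Finset.mem_univ (TO (π k)))
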